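/- Consider the pendulum-on-a-cart system with cart mass m > 0 and control force u : ℝ⁵ → ℝ continuous in all variables, locally Lipschitz in the state variables, and T-periodic in t. Let μ ∈ M = {(q,p,x,y) : 0 < q < π} be an equilibrium, and suppose there exist a closed set U ⊆ M containing μ in its interior and a C¹ function V : U × ℝ → ℝ, T-periodic in t, with V(μ, t) = 0 for all t, V(z, t) > 0 for all z ∈ U \ {μ} and all t, and with total derivative along the system, ∂V/∂t + ∇_z V · f(z, t), negative for all z ∈ U \ {μ} and all t (where f denotes the right-hand side of the system). Then for any t₀ ∈ ℝ there exist an open neighborhood B ⊆ M of μ and an initial condition (q₀, p₀, x₀, y₀) with 0 < q₀ < π such that every solution with this initial condition at time t₀ satisfies 0 < q(t) < π and (q(t), p(t), x(t), y(t)) ∉ B for all t ≥ t₀ in its interval of existence; hence global stabilization of μ is impossible for the T-periodic system. -/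

import Mathlib

open Real Set

/-- The `ṗ` component of the pendulum-on-a-cart vector field; state `z = (q, p, x, y)`. -/
noncomputable def cartPAcc (m : ℝ) (u : ℝ → ℝ → ℝ → ℝ → ℝ → ℝ)
    (z : ℝ × ℝ × ℝ × ℝ) (t : ℝ) : ℝ :=
  (u z.1 z.2.1 z.2.2.1 z.2.2.2 t * Real.sin z.1
    + z.2.1 ^ 2 * Real.sin z.1 * Real.cos z.1
    - (1 + m) * Real.cos z.1) / (m + (Real.cos z.1) ^ 2)

/-- The `ẏ` component of the pendulum-on-a-cart vector field; state `z = (q, p, x, y)`. -/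
noncomputable def cartYAcc (m : ℝ) (u : ℝ → ℝ → ℝ → ℝ → ℝ → ℝ)
    (z : ℝ × ℝ × ℝ × ℝ) (t : ℝ) : ℝ :=
  (u z.1 z.2.1 z.2.2.1 z.2.2.2 t
    + z.2.1 ^ 2 * Real.cos z.1
    - Real.sin z.1 * Real.cos z.1) / (m + (Real.cos z.1) ^ 2)

open Metric Filter Topology NNReal

/-- Solutions on a compact interval. -/
def IsSol (v : ℝ → (ℝ × ℝ × ℝ × ℝ) → (ℝ × ℝ × ℝ × ℝ)) (γ : ℝ → ℝ × ℝ × ℝ × ℝ) (a b : ℝ) : Prop :=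
  ∀ t ∈ Icc a b, HasDerivWithinAt γ (v t (γ t)) (Icc a b) t

/-- Local Lipschitz condition. -/
structure LLip (v : ℝ → (ℝ × ℝ × ℝ × ℝ) → (ℝ × ℝ × ℝ × ℝ)) : Prop where
  cont : ∀ z, Continuous fun t => v t z
  lip : ∀ R a b : ℝ, ∃ K L : ℝ≥0, ∀ t ∈ Icc a b, LipschitzOnWith K (v t) (closedBall 0 R) ∧
    ∀ z ∈ closedBall (0 : ℝ × ℝ × ℝ × ℝ) R, ‖v t z‖ ≤ L

lemma IsSol.mono {v γ a b a' b'} (h : IsSol v γ a b) (ha : a ≤ a') (hb : b' ≤ b) :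
    IsSol v γ a' b' := fun t ht =>
  (h t ⟨ha.trans ht.1, ht.2.trans hb⟩).mono (Icc_subset_Icc ha hb)

lemma IsSol.cont {v γ a b} (h : IsSol v γ a b) : ContinuousOn γ (Icc a b) :=
  fun t ht => (h t ht).continuousWithinAt

lemma IsSol.right {v γ a b} (h : IsSol v γ a b) :
    ∀ t ∈ Ico a b, HasDerivWithinAt γ (v t (γ t)) (Ici t) t := fun t ht =>
  (h t ⟨ht.1, ht.2.le⟩).mono_of_mem_nhdsWithin
    (mem_of_superset (Icc_mem_nhdsGE ht.2) (Icc_subset_Icc_left ht.1))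

lemma IsSol.bdd {v γ a b} (h : IsSol v γ a b) : ∃ R, 0 ≤ R ∧ ∀ t ∈ Icc a b, ‖γ t‖ ≤ R := by
  obtain ⟨C, hC⟩ := isCompact_Icc.exists_bound_of_continuousOn h.cont
  exact ⟨max C 0, le_max_right _ _, fun t ht => (hC t ht).trans (le_max_left _ _)⟩

/-- Clamp onto a box. -/
noncomputable def clampR (R x : ℝ) : ℝ := max (-R) (min R x)

lemma clampR_lip (R : ℝ) : LipschitzWith 1 (clampR R) := by
  unfold clampR
  exact (LipschitzWith.id.const_min R).const_max (-R)

lemma clampR_le {R : ℝ} (hR : 0 ≤ R) (x : ℝ) : |clampR R x| ≤ R := by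
  unfold clampR
  rw [abs_le]
  exact ⟨le_max_left _ _, max_le (by linarith) (min_le_left _ _)⟩

lemma clampR_eq {R x : ℝ} (h : |x| ≤ R) : clampR R x = x := by
  unfold clampR
  rw [abs_le] at h
  rw [min_eq_right h.2, max_eq_right h.1]

/-- Clamp of a state onto a box. -/
noncomputable def clampE (R : ℝ) (z : ℝ × ℝ × ℝ × ℝ) : ℝ × ℝ × ℝ × ℝ :=
  (clampR R z.1, clampR R z.2.1, clampR R z.2.2.1, clampR R z.2.2.2)

lemma norm4_le (z : ℝ × ℝ × ℝ × ℝ) (R : ℝ) :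
    ‖z‖ ≤ R ↔ |z.1| ≤ R ∧ |z.2.1| ≤ R ∧ |z.2.2.1| ≤ R ∧ |z.2.2.2| ≤ R := by
  simp [Prod.norm_def]

lemma clampE_lip (R : ℝ) : LipschitzWith 1 (clampE R) := by
  have h1 : LipschitzWith 1 (fun z : ℝ × ℝ × ℝ × ℝ => z.1) := LipschitzWith.prod_fst
  have h2 : LipschitzWith 1 (fun z : ℝ × ℝ × ℝ × ℝ => z.2) := LipschitzWith.prod_snd
  have h3 : LipschitzWith 1 (fun z : ℝ × ℝ × ℝ => z.1) := LipschitzWith.prod_fst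
  have h4 : LipschitzWith 1 (fun z : ℝ × ℝ × ℝ => z.2) := LipschitzWith.prod_snd
  have h5 : LipschitzWith 1 (fun z : ℝ × ℝ => z.1) := LipschitzWith.prod_fst
  have h6 : LipschitzWith 1 (fun z : ℝ × ℝ => z.2) := LipschitzWith.prod_snd
  have c := clampR_lip R
  have := (c.comp h1).prodMk ((c.comp (h3.comp h2)).prodMk ((c.comp (h5.comp (h4.comp h2))).prodMk
    (c.comp (h6.comp (h4.comp h2)))))
  simp only [mul_one, max_self] at this
  exact this

lemma clampE_mem {R : ℝ} (hR : 0 ≤ R) (z) : clampE R z ∈ closedBall (0 : ℝ × ℝ × ℝ × ℝ) R := by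
  rw [mem_closedBall_zero_iff, norm4_le]
  exact ⟨clampR_le hR _, clampR_le hR _, clampR_le hR _, clampR_le hR _⟩

lemma clampE_eq {R : ℝ} {z : ℝ × ℝ × ℝ × ℝ} (h : ‖z‖ ≤ R) : clampE R z = z := by
  rw [norm4_le] at h
  unfold clampE
  rw [clampR_eq h.1, clampR_eq h.2.1, clampR_eq h.2.2.1, clampR_eq h.2.2.2]

lemma sol_unique {v} (hv : LLip v) {γ η : ℝ → ℝ × ℝ × ℝ × ℝ} {a b : ℝ}
    (hγ : IsSol v γ a b) (hη : IsSol v η a b) (h0 : γ a = η a) : ∀ t ∈ Icc a b, γ t = η t := by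
  obtain ⟨R1, -, h1⟩ := hγ.bdd
  obtain ⟨R2, -, h2⟩ := hη.bdd
  obtain ⟨K, L, hK⟩ := hv.lip (max R1 R2) a b
  intro t ht
  have := dist_le_of_trajectories_ODE_of_mem (v := v) (K := K)
    (s := fun _ => closedBall 0 (max R1 R2)) (δ := 0)
    (fun t ht => (hK t ⟨ht.1, ht.2.le⟩).1) hγ.cont hγ.right
    (fun t ht => by
      rw [mem_closedBall_zero_iff]
      exact (h1 t ⟨ht.1, ht.2.le⟩).trans (le_max_left _ _)) hη.cont hη.right
    (fun t ht => by
      rw [mem_closedBall_zero_iff]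
      exact (h2 t ⟨ht.1, ht.2.le⟩).trans (le_max_right _ _)) (by simp [h0]) t ht
  rw [zero_mul] at this
  exact dist_le_zero.1 this

lemma sol_perturb {v} (hv : LLip v) {γ : ℝ → ℝ × ℝ × ℝ × ℝ} {a b : ℝ} (hab : a ≤ b)
    (hγ : IsSol v γ a b) : ∃ C : ℝ, 0 < C ∧ ∀ z0, dist z0 (γ a) * C < 1 →
      ∃ t2, b < t2 ∧ ∃ η, IsSol v η a t2 ∧ η a = z0 ∧
        ∀ t ∈ Icc a b, dist (η t) (γ t) ≤ dist z0 (γ a) * C := by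
  obtain ⟨R, hR, hRγ⟩ := hγ.bdd
  obtain ⟨K, L, hK⟩ := hv.lip (R + 2) a (b + 1)
  set w : ℝ → (ℝ × ℝ × ℝ × ℝ) → (ℝ × ℝ × ℝ × ℝ) := fun t z => v t (clampE (R + 2) z) with hw
  have hwlip : ∀ t ∈ Icc a (b + 1), LipschitzWith K (w t) := by
    intro t ht
    have := (hK t ht).1.comp (clampE_lip (R + 2)).lipschitzOnWith (s := univ)
      (fun z _ => clampE_mem (by linarith) z)
    rw [mul_one, lipschitzOnWith_univ] at this
    exact this
  have hwb : ∀ t ∈ Icc a (b + 1), ∀ z, ‖w t z‖ ≤ L := fun t ht z =>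
    (hK t ht).2 _ (clampE_mem (by linarith) z)
  refine ⟨Real.exp (K * (b - a)), Real.exp_pos _, fun z0 hz0 => ?_⟩
  have hPL : IsPicardLindelof w (⟨a, le_rfl, by linarith⟩ : Icc a (b + 1)) z0
      (L * (Real.toNNReal (b + 1 - a))) 0 L K := by
    refine ⟨fun t ht => (hwlip t ht).lipschitzOnWith, fun z _ => (hv.cont _).continuousOn,
      fun t ht z _ => hwb t ht z, ?_⟩
    have : max (b + 1 - a) (a - a) = b + 1 - a := max_eq_left (by linarith)
    simp only [this, NNReal.coe_mul, NNReal.coe_zero, sub_zero]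
    rw [Real.coe_toNNReal _ (by linarith)]
  obtain ⟨η, hη0, hη⟩ := hPL.exists_eq_forall_mem_Icc_hasDerivWithinAt₀
  have hηw : IsSol w η a (b + 1) := hη
  have hγw : IsSol w γ a b := by
    intro t ht
    have := hγ t ht
    simp only [hw]
    rwa [clampE_eq ((hRγ t ht).trans (by linarith))]
  have hdist : ∀ t ∈ Icc a b, dist (η t) (γ t) ≤ dist z0 (γ a) * Real.exp (K * (b - a)) := by
    intro t ht
    have hηb := hηw.mono le_rfl (b' := b) (by linarith)
    have := dist_le_of_trajectories_ODE_of_mem (v := w) (K := K) (s := fun _ => univ)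
      (δ := dist z0 (γ a))
      (fun t ht => (hwlip t ⟨ht.1, by linarith [ht.2]⟩).lipschitzOnWith) hηb.cont hηb.right
      (fun _ _ => trivial) hγw.cont hγw.right (fun _ _ => trivial)
      (by rw [show η a = z0 from hη0]) t ht
    refine this.trans ?_
    gcongr
    exact ht.2
  have hn : ∀ t ∈ Icc a b, ‖η t‖ < R + 1 := by
    intro t ht
    have h1 := hdist t ht
    have h2 := hRγ t ht
    have h3 : ‖η t‖ ≤ ‖γ t‖ + dist (η t) (γ t) := by
      rw [dist_eq_norm]
      simpa using norm_add_le (γ t) (η t - γ t)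
    linarith
  -- extend a little bit
  have hc : ContinuousWithinAt (fun t => ‖η t‖) (Icc a (b + 1)) b :=
    (hηw.cont b ⟨hab, by linarith⟩).norm
  have hev : ∀ᶠ t in 𝓝[Icc a (b + 1)] b, ‖η t‖ < R + 1 := hc.eventually_lt_const (hn b ⟨hab, le_rfl⟩)
  obtain ⟨ε, hε, hev⟩ := Metric.mem_nhdsWithin_iff.1 hev
  refine ⟨b + min (ε / 2) 1, by have : 0 < min (ε / 2) 1 := by positivity
                                linarith, η, ?_, hη0, hdist⟩
  have hm1 := min_le_left (ε / 2) 1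
  have hm2 := min_le_right (ε / 2) 1
  intro t ht
  have h1 := (hηw.mono le_rfl (b' := b + min (ε / 2) 1) (by linarith)) t ht
  have h2 : ‖η t‖ ≤ R + 2 := by
    rcases le_total t b with h | h
    · linarith [hn t ⟨ht.1, h⟩]
    · have : ‖η t‖ < R + 1 := @hev t
        ⟨by rw [Real.ball_eq_Ioo]; constructor <;> linarith [ht.2], ht.1, by linarith [ht.2]⟩
      linarith
  simp only [hw] at h1
  rwa [clampE_eq h2] at h1

lemma exit_1d {w v : ℝ → ℝ} {a c t1 t2 : ℝ} (h12 : t1 < t2) 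
    (hw : ∀ t ∈ Icc t1 t2, HasDerivWithinAt w (v t) (Icc t1 t2) t)
    (hv : HasDerivWithinAt v a (Icc t1 t2) t1) (ha : a < 0) (hw0 : w t1 = c) (hv0 : v t1 ≤ 0) :
    ∃ t ∈ Icc t1 t2, w t < c := by
  have h1 := hasDerivWithinAt_iff_tendsto_slope.1 hv
  have h2 := h1.eventually (gt_mem_nhds ha)
  obtain ⟨ε, hε, h2⟩ := Metric.mem_nhdsWithin_iff.1 h2
  set t3 := min t2 (t1 + ε / 2) with ht3
  have h13 : t1 < t3 := lt_min h12 (by linarith)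
  have h32 : t3 ≤ t2 := min_le_left _ _
  have h3e : t3 ≤ t1 + ε / 2 := min_le_right _ _
  have hneg : ∀ t ∈ Ioo t1 t3, v t < 0 := by
    intro t ht
    have : slope v t1 t < 0 := @h2 t
      ⟨by rw [Real.ball_eq_Ioo]; constructor <;> linarith [ht.1, ht.2],
        ⟨ht.1.le, by linarith [ht.2]⟩, by simpa using ht.1.ne'⟩
    rw [slope_def_field, div_neg_iff] at this
    rcases this with h | h <;> linarith [ht.1, h.1, h.2]
  have hanti : StrictAntiOn w (Icc t1 t3) := by
    apply strictAntiOn_of_deriv_neg (convex_Icc _ _)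
    · exact fun t ht => ((hw t ⟨ht.1, ht.2.trans h32⟩).continuousWithinAt).mono
        (Icc_subset_Icc_right h32)
    · intro t ht
      rw [interior_Icc] at ht
      have := (hw t ⟨ht.1.le, ht.2.le.trans h32⟩).hasDerivAt
        (Icc_mem_nhds ht.1 (ht.2.trans_le h32))
      rw [this.deriv]
      exact hneg t ht
  exact ⟨t3, ⟨h13.le, h32⟩, hw0 ▸ hanti ⟨le_rfl, h13.le⟩ ⟨h13.le, le_rfl⟩ h13⟩

lemma arrive_1d {w : ℝ → ℝ} {a c t0 t1 : ℝ} (h01 : t0 < t1)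
    (hw : HasDerivWithinAt w a (Icc t0 t1) t1) (h1 : w t1 = c)
    (hpos : ∀ t ∈ Ico t0 t1, c < w t) : a ≤ 0 := by
  have h := hasDerivWithinAt_iff_tendsto_slope.1 (hw.mono Ico_subset_Icc_self)
  have e : Ico t0 t1 \ {t1} = Ico t0 t1 := by
    ext t; simp only [Set.mem_sdiff, mem_Ico, mem_singleton_iff]
    exact ⟨fun h => h.1, fun h => ⟨h, h.2.ne⟩⟩
  rw [e] at h
  have : (𝓝[Ico t0 t1] t1).NeBot := by
    rw [nhdsWithin_Ico_eq_nhdsLT h01]; infer_instance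
  refine le_of_tendsto h ?_
  filter_upwards [self_mem_nhdsWithin] with t ht
  rw [slope_def_field]
  exact div_nonpos_of_nonneg_of_nonpos (by linarith [hpos t ht]) (by linarith [ht.2])

lemma HasDerivWithinAt.fst' {γ : ℝ → ℝ × ℝ × ℝ × ℝ} {d s t} (h : HasDerivWithinAt γ d s t) :
    HasDerivWithinAt (fun t => (γ t).1) d.1 s t :=
  (ContinuousLinearMap.fst ℝ ℝ (ℝ × ℝ × ℝ)).hasFDerivAt.comp_hasDerivWithinAt t h

lemma HasDerivWithinAt.snd1' {γ : ℝ → ℝ × ℝ × ℝ × ℝ} {d s t} (h : HasDerivWithinAt γ d s t) :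
    HasDerivWithinAt (fun t => (γ t).2.1) d.2.1 s t :=
  (ContinuousLinearMap.fst ℝ ℝ (ℝ × ℝ)).hasFDerivAt.comp_hasDerivWithinAt t
    ((ContinuousLinearMap.snd ℝ ℝ (ℝ × ℝ × ℝ)).hasFDerivAt.comp_hasDerivWithinAt t h)

lemma sol_exit {v} (hv : LLip v) (hq : ∀ z t, (v t z).1 = z.2.1)
    (hb0 : ∀ z t, z.1 = 0 → (v t z).2.1 < 0) (hbπ : ∀ z t, z.1 = π → 0 < (v t z).2.1)
    {γ : ℝ → ℝ × ℝ × ℝ × ℝ} {t0 t1 : ℝ} (hγ : IsSol v γ t0 t1)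
    (hp : (γ t0).2.1 = 0) (hex : ¬ ∀ t ∈ Icc t0 t1, 0 < (γ t).1 ∧ (γ t).1 < π) :
    ∃ t2, t0 ≤ t2 ∧ ∃ η, IsSol v η t0 t2 ∧ η t0 = γ t0 ∧ ((η t2).1 < 0 ∨ π < (η t2).1) := by
  push Not at hex
  obtain ⟨s, hs, hs'⟩ := hex
  have hcl : IsClosed (Icc t0 t1 ∩ (fun t => (γ t).1) ⁻¹' (Ioo 0 π)ᶜ) :=
    (continuous_fst.comp_continuousOn hγ.cont).preimage_isClosed_of_isClosed isClosed_Icc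
      isOpen_Ioo.isClosed_compl
  have hcomp : IsCompact (Icc t0 t1 ∩ (fun t => (γ t).1) ⁻¹' (Ioo 0 π)ᶜ) :=
    isCompact_Icc.of_isClosed_subset hcl inter_subset_left
  obtain ⟨τ, ⟨hτ, hτ'⟩, hmin⟩ := hcomp.exists_isLeast
    ⟨s, hs, by simp only [mem_preimage, mem_compl_iff, mem_Ioo, not_and, not_lt]; exact hs'⟩
  have hbefore : ∀ t ∈ Ico t0 τ, 0 < (γ t).1 ∧ (γ t).1 < π := by
    intro t ht
    by_contra hcon
    have := hmin ⟨⟨ht.1, ht.2.le.trans hτ.2⟩, hcon⟩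
    exact absurd ht.2 (not_lt.2 this)
  have hγτ : IsSol v γ t0 τ := hγ.mono le_rfl hτ.2
  have hderτ := (hγτ τ ⟨hτ.1, le_rfl⟩).fst'
  rw [hq] at hderτ
  obtain ⟨C, hC, hpert⟩ := sol_perturb hv hτ.1 hγτ
  obtain ⟨t2, ht2, η, hη, hη0, hηγ⟩ := hpert (γ t0) (by simp)
  have heq : η τ = γ τ := by
    have := hηγ τ ⟨hτ.1, le_rfl⟩
    rw [dist_self, zero_mul] at this
    exact dist_le_zero.1 this
  have hη' := hη.mono (a' := τ) hτ.1 le_rfl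
  have hd1 : ∀ t ∈ Icc τ t2, HasDerivWithinAt (fun t => (η t).1) ((η t).2.1) (Icc τ t2) t := by
    intro t ht
    have := (hη' t ht).fst'
    rwa [hq] at this
  have hd2 := (hη' τ ⟨le_rfl, ht2.le⟩).snd1'
  rcases lt_trichotomy (γ τ).1 0 with h | h | h
  · exact ⟨τ, hτ.1, γ, hγτ, rfl, Or.inl h⟩
  · have hpτ : (γ τ).2.1 ≤ 0 := by
      rcases eq_or_lt_of_le hτ.1 with h' | h'
      · rw [← h', hp]
      · exact arrive_1d h' hderτ h fun t ht => (hbefore t ht).1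
    obtain ⟨t, ht, hlt⟩ := exit_1d (c := 0) ht2 hd1 hd2 (hb0 _ _ (by rw [heq, h]))
      (by simp only [heq, h]) (by simp only [heq]; exact hpτ)
    exact ⟨t, hτ.1.trans ht.1, η, hη.mono le_rfl ht.2, hη0, Or.inl hlt⟩
  rcases lt_trichotomy (γ τ).1 π with h' | h' | h'
  · exact absurd ⟨h, h'⟩ hτ'
  · have hpτ : -(γ τ).2.1 ≤ 0 := by
      rcases eq_or_lt_of_le hτ.1 with h'' | h''
      · rw [← h'', hp]; simp
      · exact arrive_1d h'' hderτ.neg (c := -π) (by simp [h'])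
          fun t ht => by simpa using (hbefore t ht).2
    obtain ⟨t, ht, hlt⟩ := exit_1d (c := -π) ht2 (fun t ht => (hd1 t ht).neg) hd2.neg
      (by have := hbπ (η τ) τ (by rw [heq, h']); linarith)
      (by simp [heq, h']) (by simpa only [Pi.neg_apply, heq] using hpτ)
    refine ⟨t, hτ.1.trans ht.1, η, hη.mono le_rfl ht.2, hη0, Or.inr ?_⟩
    simpa using hlt
  · exact ⟨τ, hτ.1, γ, hγτ, rfl, Or.inr h'⟩

lemma isSol_const (v) (z : ℝ × ℝ × ℝ × ℝ) (t0 : ℝ) : IsSol v (fun _ => z) t0 t0 := by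
  intro t ht
  exact HasFDerivWithinAt.of_subsingleton (by rw [Icc_self]; exact subsingleton_singleton)

lemma sol_path {v} (hv : LLip v) (hq : ∀ z t, (v t z).1 = z.2.1)
    (hb0 : ∀ z t, z.1 = 0 → (v t z).2.1 < 0) (hbπ : ∀ z t, z.1 = π → 0 < (v t z).2.1)
    (N : Set ((ℝ × ℝ × ℝ × ℝ) × ℝ)) (hN : IsOpen N) (hNM : ∀ w ∈ N, 0 < w.1.1 ∧ w.1.1 < π)
    (hinv : ∀ γ a b, IsSol v γ a b → a ≤ b → (γ a, a) ∈ N → (γ b, b) ∈ N)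
    (μ : ℝ × ℝ × ℝ × ℝ) (hμN : ∀ t, (μ, t) ∈ N) (hμp : μ.2.1 = 0) (t0 : ℝ) :
    ∃ z0 : ℝ × ℝ × ℝ × ℝ, ∀ t1, t0 ≤ t1 → ∀ γ, IsSol v γ t0 t1 → γ t0 = z0 →
      (0 < (γ t1).1 ∧ (γ t1).1 < π) ∧ (γ t1, t1) ∉ N := by
  set P : ℝ → ℝ × ℝ × ℝ × ℝ := fun s => (μ.1 + s, μ.2) with hP
  have hPc : Continuous P := by fun_prop
  set A : Set (ℝ × ℝ × ℝ × ℝ) := {z | ∃ t, t0 ≤ t ∧ ∃ γ, IsSol v γ t0 t ∧ γ t0 = z ∧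
    ((γ t).1 < 0 ∨ π < (γ t).1)} with hA
  set B : Set (ℝ × ℝ × ℝ × ℝ) := {z | ∃ t, t0 ≤ t ∧ ∃ γ, IsSol v γ t0 t ∧ γ t0 = z ∧
    (∀ s ∈ Icc t0 t, 0 < (γ s).1 ∧ (γ s).1 < π) ∧ (γ t, t) ∈ N} with hB
  have hfst : ∀ z w : ℝ × ℝ × ℝ × ℝ, |z.1 - w.1| ≤ dist z w := by
    intro z w
    rw [← Real.dist_eq, Prod.dist_eq]; exact le_max_left _ _
  have key : ∀ (γ : ℝ → ℝ × ℝ × ℝ × ℝ) t, t0 ≤ t → IsSol v γ t0 t → ∀ ε > 0, ∀ᶠ z in 𝓝 (γ t0),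
      ∃ η, IsSol v η t0 t ∧ η t0 = z ∧ ∀ s ∈ Icc t0 t, dist (η s) (γ s) < ε := by
    intro γ t ht hγ ε hε
    obtain ⟨C, hC, hpert⟩ := sol_perturb hv ht hγ
    filter_upwards [Metric.ball_mem_nhds (γ t0) (show 0 < min 1 ε / C by positivity)] with z hz
    rw [mem_ball, lt_div_iff₀ hC] at hz
    obtain ⟨t2, ht2, η, hη, hη0, hηγ⟩ := hpert z (hz.trans_le (min_le_left _ _))
    exact ⟨η, hη.mono le_rfl ht2.le, hη0, fun s hs =>
      (hηγ s hs).trans_lt (hz.trans_le (min_le_right _ _))⟩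
  have hAo : IsOpen A := by
    rw [isOpen_iff_mem_nhds]
    rintro z ⟨t, ht, γ, hγ, rfl, h⟩
    rcases h with h | h
    · filter_upwards [key γ t ht hγ (-(γ t).1) (by linarith)] with z ⟨η, hη, hη0, hd⟩
      have h1 := hd t ⟨ht, le_rfl⟩
      have h2 := abs_le.1 (hfst (η t) (γ t))
      exact ⟨t, ht, η, hη, hη0, Or.inl (by linarith)⟩
    · filter_upwards [key γ t ht hγ ((γ t).1 - π) (by linarith)] with z ⟨η, hη, hη0, hd⟩
      have h1 := hd t ⟨ht, le_rfl⟩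
      have h2 := abs_le.1 (hfst (η t) (γ t))
      exact ⟨t, ht, η, hη, hη0, Or.inr (by linarith)⟩
  have hBo : IsOpen B := by
    rw [isOpen_iff_mem_nhds]
    rintro z ⟨t, ht, γ, hγ, rfl, hM, hNt⟩
    have hqc : ContinuousOn (fun s => (γ s).1) (Icc t0 t) :=
      continuous_fst.comp_continuousOn hγ.cont
    obtain ⟨s1, hs1, hs1'⟩ := isCompact_Icc.exists_isMinOn ⟨t0, le_rfl, ht⟩ hqc
    obtain ⟨s2, hs2, hs2'⟩ := isCompact_Icc.exists_isMaxOn ⟨t0, le_rfl, ht⟩ hqc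
    have hNo : IsOpen {z | (z, t) ∈ N} := hN.preimage (by fun_prop)
    obtain ⟨ε, hε, hεN⟩ := Metric.isOpen_iff.1 hNo (γ t) hNt
    have e1 := (hM s1 hs1).1
    have e2 := (hM s2 hs2).2
    filter_upwards [key γ t ht hγ (min ε (min (γ s1).1 (π - (γ s2).1)))
      (lt_min hε (lt_min e1 (by linarith)))] with z ⟨η, hη, hη0, hd⟩
    refine ⟨t, ht, η, hη, hη0, fun s hs => ?_, hεN ?_⟩
    · have h1 := hd s hs
      simp only [lt_min_iff] at h1
      have h2 := abs_le.1 (hfst (η s) (γ s))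
      have h3 : (γ s1).1 ≤ (γ s).1 := hs1' hs
      have h4 : (γ s).1 ≤ (γ s2).1 := hs2' hs
      constructor <;> linarith
    · exact (hd t ⟨ht, le_rfl⟩).trans_le (min_le_left _ _)
  have hdisj : ∀ z, z ∈ A → z ∈ B → False := by
    rintro z ⟨t, ht, γ, hγ, hγ0, hexit⟩ ⟨t', ht', η, hη, hη0, hM, hNt⟩
    rcases le_total t t' with h | h
    · have := sol_unique hv hγ (hη.mono le_rfl h) (hγ0.trans hη0.symm) t ⟨ht, le_rfl⟩
      rw [this] at hexit
      have := hM t ⟨ht, h⟩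
      rcases hexit with h | h <;> linarith
    · have := sol_unique hv (hγ.mono le_rfl h) hη (hγ0.trans hη0.symm) t' ⟨ht', le_rfl⟩
      rw [← this] at hNt
      have := hNM _ (hinv γ t' t (hγ.mono ht' le_rfl) h hNt)
      rcases hexit with h | h <;> linarith
  have hex : ∃ s, P s ∉ A ∧ P s ∉ B := by
    by_contra hcon
    push Not at hcon
    have := isPreconnected_univ (α := ℝ) (P ⁻¹' A) (P ⁻¹' B) (hAo.preimage hPc) (hBo.preimage hPc)
      (fun s _ => by
        by_cases h : P s ∈ A
        · exact Or.inl h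
        · exact Or.inr (hcon s h))
      ⟨-μ.1 - 1, trivial, t0, le_rfl, fun _ => P (-μ.1 - 1), isSol_const _ _ _, rfl,
        Or.inl (by simp only [hP]; linarith)⟩
      ⟨0, trivial, t0, le_rfl, fun _ => P 0, isSol_const _ _ _, rfl,
        fun s _ => by simpa [hP] using hNM _ (hμN t0), by simpa [hP] using hμN t0⟩
    obtain ⟨s, -, h1, h2⟩ := this
    exact hdisj _ h1 h2
  obtain ⟨s, hsA, hsB⟩ := hex
  refine ⟨P s, fun t1 ht1 γ hγ hγ0 => ?_⟩
  have hM : ∀ t ∈ Icc t0 t1, 0 < (γ t).1 ∧ (γ t).1 < π := by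
    by_contra hcon
    obtain ⟨t2, ht2, η, hη, hη0, h⟩ := sol_exit hv hq hb0 hbπ hγ (by rw [hγ0]; exact hμp) hcon
    exact hsA ⟨t2, ht2, η, hη, hη0.trans hγ0, h⟩
  exact ⟨hM t1 ⟨ht1, le_rfl⟩, fun h => hsB ⟨t1, ht1, γ, hγ, hγ0, hM, h⟩⟩

lemma sol_invariant {v} {γ : ℝ → ℝ × ℝ × ℝ × ℝ} {τ t1 : ℝ} (hγ : IsSol v γ τ t1)
    (μ : ℝ × ℝ × ℝ × ℝ) (V : (ℝ × ℝ × ℝ × ℝ) × ℝ → ℝ)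
    (DV : (ℝ × ℝ × ℝ × ℝ) × ℝ → ((ℝ × ℝ × ℝ × ℝ) × ℝ) →L[ℝ] ℝ) (r c : ℝ)
    (hdiff : ∀ z ∈ closedBall μ r, ∀ t, HasFDerivAt V (DV (z, t)) (z, t))
    (hneg : ∀ z ∈ closedBall μ r, ∀ t, DV (z, t) (v t z, 1) ≤ 0)
    (hsph : ∀ z ∈ sphere μ r, ∀ t, c ≤ V (z, t))
    (h0 : γ τ ∈ ball μ r) (h0' : V (γ τ, τ) < c) :
    ∀ t ∈ Icc τ t1, γ t ∈ ball μ r ∧ V (γ t, t) < c := by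
  have hdec : ∀ t, τ ≤ t → t ≤ t1 → (∀ s ∈ Icc τ t, γ s ∈ closedBall μ r) →
      V (γ t, t) < c := by
    intro t ht ht1 hs
    have hγt := hγ.mono le_rfl ht1
    refine lt_of_le_of_lt ?_ h0'
    refine image_le_of_deriv_right_le_deriv_boundary (f := fun s => V (γ s, s))
      (f' := fun s => DV (γ s, s) (v s (γ s), 1)) (B := fun _ => V (γ τ, τ)) (B' := fun _ => 0)
      (a := τ) (b := t) ?_ ?_ le_rfl continuousOn_const
      (fun s _ => hasDerivWithinAt_const _ _ _) ?_ ⟨ht, le_rfl⟩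
    · intro s hs'
      have h1 : ContinuousWithinAt (fun s => (γ s, s)) (Icc τ t) s :=
        (hγt.cont s hs').prodMk continuousWithinAt_id
      exact ContinuousAt.comp_continuousWithinAt (f := fun s => (γ s, s)) (g := V)
        (hdiff _ (hs s hs') s).continuousAt h1
    · intro s hs'
      have h1 := (hγt.right s hs').prodMk (hasDerivWithinAt_id s (Ici s))
      exact HasFDerivAt.comp_hasDerivWithinAt (f := fun s => (γ s, s)) s
        (hdiff _ (hs s ⟨hs'.1, hs'.2.le⟩) s) h1
    · intro s hs'
      exact hneg _ (hs s ⟨hs'.1, hs'.2.le⟩) s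
  have hdc : ContinuousOn (fun s => dist (γ s) μ) (Icc τ t1) := 
    (continuous_id.dist continuous_const).comp_continuousOn hγ.cont
  have hIVT : ∀ s ∈ Icc τ t1, r ≤ dist (γ s) μ → ∃ s' ∈ Icc τ s, dist (γ s') μ = r := by
    intro s hs hr
    have := intermediate_value_Icc hs.1 (hdc.mono (Icc_subset_Icc_right hs.2))
    obtain ⟨s', hs', h⟩ := this ⟨(mem_ball.1 h0).le, hr⟩
    exact ⟨s', hs', h⟩
  have hball : ∀ t ∈ Icc τ t1, γ t ∈ ball μ r := by
    by_contra hcon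
    push Not at hcon
    obtain ⟨s, hs, hs'⟩ := hcon
    rw [mem_ball, not_lt] at hs'
    obtain ⟨s1, hs1, hs1'⟩ := hIVT s hs hs'
    have hcl : IsClosed (Icc τ t1 ∩ (fun s => dist (γ s) μ) ⁻¹' {r}) :=
      hdc.preimage_isClosed_of_isClosed isClosed_Icc isClosed_singleton
    have hcomp := isCompact_Icc.of_isClosed_subset hcl inter_subset_left
    obtain ⟨σ, ⟨hσ, hσ'⟩, hmin⟩ := hcomp.exists_isLeast ⟨s1, ⟨hs1.1, hs1.2.trans hs.2⟩, hs1'⟩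
    have hσr : dist (γ σ) μ = r := hσ'
    have := hdec σ hσ.1 hσ.2 (by
      intro w hw
      rw [mem_closedBall]
      by_contra hlt
      rw [not_le] at hlt
      obtain ⟨w', hw', e⟩ := hIVT w ⟨hw.1, hw.2.trans hσ.2⟩ hlt.le
      have h1 : σ ≤ w' := hmin ⟨⟨hw'.1, hw'.2.trans (hw.2.trans hσ.2)⟩, e⟩
      have h2 : w = σ := le_antisymm hw.2 (h1.trans hw'.2)
      rw [h2, hσr] at hlt
      exact lt_irrefl _ hlt)
    exact absurd this (not_lt.2 (hsph _ hσr σ))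
  intro t ht
  exact ⟨hball t ht, hdec t ht.1 ht.2 fun s hs =>
    ball_subset_closedBall (hball s ⟨hs.1, hs.2.trans ht.2⟩)⟩

/-- The full vector field. -/
noncomputable def cartV (m : ℝ) (u : ℝ → ℝ → ℝ → ℝ → ℝ → ℝ) (t : ℝ)
    (z : ℝ × ℝ × ℝ × ℝ) : ℝ × ℝ × ℝ × ℝ :=
  (z.2.1, cartPAcc m u z t, z.2.2.2, cartYAcc m u z t)

lemma contDiff_lip (A : ℝ × ℝ × ℝ × ℝ → ℝ) (hA : ContDiff ℝ 1 A) (R : ℝ) :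
    ∃ K C : ℝ, 0 ≤ K ∧ 0 ≤ C ∧ (∀ z ∈ closedBall (0 : ℝ × ℝ × ℝ × ℝ) R, |A z| ≤ C) ∧
      ∀ z ∈ closedBall (0 : ℝ × ℝ × ℝ × ℝ) R, ∀ w ∈ closedBall (0 : ℝ × ℝ × ℝ × ℝ) R,
        |A z - A w| ≤ K * dist z w := by
  have hc : IsCompact (closedBall (0 : ℝ × ℝ × ℝ × ℝ) R) := isCompact_closedBall _ _
  obtain ⟨C, hC⟩ := hc.exists_bound_of_continuousOn hA.continuous.continuousOn
  obtain ⟨K, hK⟩ := (hA.locallyLipschitz.locallyLipschitzOn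
    (s := closedBall (0 : ℝ × ℝ × ℝ × ℝ) R)).exists_lipschitzOnWith_of_compact hc
  refine ⟨K, max C 0, K.2, le_max_right _ _, fun z hz => (hC z hz).trans (le_max_left _ _),
    fun z hz w hw => ?_⟩
  have := hK.dist_le_mul z hz w hw
  rwa [Real.dist_eq] at this

lemma lip_comb (u : ℝ → ℝ → ℝ → ℝ → ℝ → ℝ)
    (hu_cont : Continuous fun x : ℝ × ℝ × ℝ × ℝ × ℝ =>
      u x.1 x.2.1 x.2.2.1 x.2.2.2.1 x.2.2.2.2)
    (hu_lip : ∀ K : Set (ℝ × ℝ × ℝ × ℝ × ℝ), IsCompact K → ∃ L : ℝ,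
      ∀ a ∈ K, ∀ b ∈ K, a.2.2.2.2 = b.2.2.2.2 →
        |u a.1 a.2.1 a.2.2.1 a.2.2.2.1 a.2.2.2.2
          - u b.1 b.2.1 b.2.2.1 b.2.2.2.1 b.2.2.2.2| ≤
          L * dist ((a.1, a.2.1, a.2.2.1, a.2.2.2.1) : ℝ × ℝ × ℝ × ℝ)
                   ((b.1, b.2.1, b.2.2.1, b.2.2.2.1) : ℝ × ℝ × ℝ × ℝ))
    (A B : ℝ × ℝ × ℝ × ℝ → ℝ) (hA : ContDiff ℝ 1 A) (hB : ContDiff ℝ 1 B) (R a b : ℝ) :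
    ∃ K L : ℝ≥0, ∀ t ∈ Icc a b,
      LipschitzOnWith K (fun z : ℝ × ℝ × ℝ × ℝ => u z.1 z.2.1 z.2.2.1 z.2.2.2 t * A z + B z)
        (closedBall 0 R) ∧
      ∀ z ∈ closedBall (0 : ℝ × ℝ × ℝ × ℝ) R,
        |u z.1 z.2.1 z.2.2.1 z.2.2.2 t * A z + B z| ≤ L := by
  obtain ⟨KA, CA, hKA, hCA, hA1, hA2⟩ := contDiff_lip A hA R
  obtain ⟨KB, CB, hKB, hCB, hB1, hB2⟩ := contDiff_lip B hB R
  set S := max R (max |a| |b|) with hS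
  have hc : IsCompact (closedBall (0 : ℝ × ℝ × ℝ × ℝ × ℝ) S) := isCompact_closedBall _ _
  obtain ⟨C0, hC0⟩ := hc.exists_bound_of_continuousOn hu_cont.continuousOn
  obtain ⟨L0, hL0⟩ := hu_lip _ hc
  have hmem : ∀ t ∈ Icc a b, ∀ z ∈ closedBall (0 : ℝ × ℝ × ℝ × ℝ) R,
      (z.1, z.2.1, z.2.2.1, z.2.2.2, t) ∈ closedBall (0 : ℝ × ℝ × ℝ × ℝ × ℝ) S := by
    intro t ht z hz
    rw [mem_closedBall_zero_iff, norm4_le] at hz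
    have h1 : R ≤ S := le_max_left _ _
    have h2 : |t| ≤ S := (abs_le_max_abs_abs ht.1 ht.2).trans (le_max_right _ _)
    rw [mem_closedBall_zero_iff]
    simp only [Prod.norm_def, Real.norm_eq_abs, max_le_iff]
    exact ⟨hz.1.trans h1, hz.2.1.trans h1, hz.2.2.1.trans h1, hz.2.2.2.trans h1, h2⟩
  set C := max C0 0 with hCdef
  set L := max L0 0 with hLdef
  have hCn : 0 ≤ C := le_max_right _ _
  have hLn : 0 ≤ L := le_max_right _ _
  have hub : ∀ t ∈ Icc a b, ∀ z ∈ closedBall (0 : ℝ × ℝ × ℝ × ℝ) R,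
      |u z.1 z.2.1 z.2.2.1 z.2.2.2 t| ≤ C := fun t ht z hz =>
    (hC0 _ (hmem t ht z hz)).trans (le_max_left _ _)
  have hul : ∀ t ∈ Icc a b, ∀ z ∈ closedBall (0 : ℝ × ℝ × ℝ × ℝ) R,
      ∀ w ∈ closedBall (0 : ℝ × ℝ × ℝ × ℝ) R,
      |u z.1 z.2.1 z.2.2.1 z.2.2.2 t - u w.1 w.2.1 w.2.2.1 w.2.2.2 t| ≤ L * dist z w := by
    intro t ht z hz w hw
    refine (hL0 _ (hmem t ht z hz) _ (hmem t ht w hw) rfl).trans ?_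
    exact mul_le_mul_of_nonneg_right (le_max_left _ _) dist_nonneg
  refine ⟨NNReal.mk (C * KA + L * CA + KB) (by positivity), NNReal.mk (C * CA + CB) (by positivity),
    fun t ht => ⟨?_, ?_⟩⟩
  · refine LipschitzOnWith.of_dist_le_mul fun z hz w hw => ?_
    rw [Real.dist_eq, NNReal.coe_mk]
    set x := u z.1 z.2.1 z.2.2.1 z.2.2.2 t
    set y := u w.1 w.2.1 w.2.2.1 w.2.2.2 t
    have e : x * A z + B z - (y * A w + B w) =
        x * (A z - A w) + (x - y) * A w + (B z - B w) := by ring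
    rw [e]
    have hd : 0 ≤ dist z w := dist_nonneg
    have h1 : |x * (A z - A w)| ≤ C * (KA * dist z w) := by
      rw [abs_mul]
      exact mul_le_mul (hub t ht z hz) (hA2 z hz w hw) (abs_nonneg _) hCn
    have h2 : |(x - y) * A w| ≤ (L * dist z w) * CA := by
      rw [abs_mul]
      exact mul_le_mul (hul t ht z hz w hw) (hA1 w hw) (abs_nonneg _) (by positivity)
    have h3 := hB2 z hz w hw
    have h4 := abs_add_three (x * (A z - A w)) ((x - y) * A w) (B z - B w)
    linarith
  · intro z hz
    rw [NNReal.coe_mk]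
    refine (abs_add_le _ _).trans (add_le_add ?_ (hB1 z hz))
    rw [abs_mul]
    exact mul_le_mul (hub t ht z hz) (hA1 z hz) (abs_nonneg _) hCn

lemma cartV_llip (m : ℝ) (hm : 0 < m) (u : ℝ → ℝ → ℝ → ℝ → ℝ → ℝ)
    (hu_cont : Continuous fun x : ℝ × ℝ × ℝ × ℝ × ℝ =>
      u x.1 x.2.1 x.2.2.1 x.2.2.2.1 x.2.2.2.2)
    (hu_lip : ∀ K : Set (ℝ × ℝ × ℝ × ℝ × ℝ), IsCompact K → ∃ L : ℝ,
      ∀ a ∈ K, ∀ b ∈ K, a.2.2.2.2 = b.2.2.2.2 →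
        |u a.1 a.2.1 a.2.2.1 a.2.2.2.1 a.2.2.2.2
          - u b.1 b.2.1 b.2.2.1 b.2.2.2.1 b.2.2.2.2| ≤
          L * dist ((a.1, a.2.1, a.2.2.1, a.2.2.2.1) : ℝ × ℝ × ℝ × ℝ)
                   ((b.1, b.2.1, b.2.2.1, b.2.2.2.1) : ℝ × ℝ × ℝ × ℝ)) :
    LLip (cartV m u) := by
  have hpos : ∀ z : ℝ × ℝ × ℝ × ℝ, m + (Real.cos z.1) ^ 2 ≠ 0 := fun z => by positivity
  constructor
  · intro z
    have h : Continuous fun t => u z.1 z.2.1 z.2.2.1 z.2.2.2 t :=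
      hu_cont.comp (f := fun t : ℝ => (z.1, z.2.1, z.2.2.1, z.2.2.2, t)) (by fun_prop)
    unfold cartV cartPAcc cartYAcc
    fun_prop
  · intro R a b
    obtain ⟨K1, L1, h1⟩ := lip_comb u hu_cont hu_lip
      (fun z => Real.sin z.1 / (m + (Real.cos z.1) ^ 2))
      (fun z => (z.2.1 ^ 2 * Real.sin z.1 * Real.cos z.1 - (1 + m) * Real.cos z.1) /
        (m + (Real.cos z.1) ^ 2))
      (ContDiff.div (by fun_prop) (by fun_prop) hpos)
      (ContDiff.div (by fun_prop) (by fun_prop) hpos) R a b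
    obtain ⟨K2, L2, h2⟩ := lip_comb u hu_cont hu_lip
      (fun z => 1 / (m + (Real.cos z.1) ^ 2))
      (fun z => (z.2.1 ^ 2 * Real.cos z.1 - Real.sin z.1 * Real.cos z.1) /
        (m + (Real.cos z.1) ^ 2))
      (ContDiff.div (by fun_prop) (by fun_prop) hpos)
      (ContDiff.div (by fun_prop) (by fun_prop) hpos) R a b
    have e1 : ∀ t, (fun z : ℝ × ℝ × ℝ × ℝ => u z.1 z.2.1 z.2.2.1 z.2.2.2 t *
        (Real.sin z.1 / (m + (Real.cos z.1) ^ 2)) +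
        (z.2.1 ^ 2 * Real.sin z.1 * Real.cos z.1 - (1 + m) * Real.cos z.1) /
        (m + (Real.cos z.1) ^ 2)) = fun z => cartPAcc m u z t := by
      intro t; funext z; unfold cartPAcc; ring
    have e2 : ∀ t, (fun z : ℝ × ℝ × ℝ × ℝ => u z.1 z.2.1 z.2.2.1 z.2.2.2 t *
        (1 / (m + (Real.cos z.1) ^ 2)) +
        (z.2.1 ^ 2 * Real.cos z.1 - Real.sin z.1 * Real.cos z.1) /
        (m + (Real.cos z.1) ^ 2)) = fun z => cartYAcc m u z t := by
      intro t; funext z; unfold cartYAcc; ring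
    have l2 : LipschitzWith 1 (fun z : ℝ × ℝ × ℝ × ℝ => z.2) := LipschitzWith.prod_snd
    have l3 : LipschitzWith 1 (fun z : ℝ × ℝ × ℝ => z.1) := LipschitzWith.prod_fst
    have l4 : LipschitzWith 1 (fun z : ℝ × ℝ × ℝ => z.2) := LipschitzWith.prod_snd
    have l6 : LipschitzWith 1 (fun z : ℝ × ℝ => z.2) := LipschitzWith.prod_snd
    refine ⟨max (1 * 1) (max K1 (max (1 * (1 * 1)) K2)), max (max L1 L2) R.toNNReal, fun t ht => ⟨?_, ?_⟩⟩
    · have p1 := (h1 t ht).1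
      have p2 := (h2 t ht).1
      rw [e1] at p1
      rw [e2] at p2
      exact ((l3.comp l2).lipschitzOnWith).prodMk (p1.prodMk
        (((l6.comp (l4.comp l2)).lipschitzOnWith).prodMk p2))
    · intro z hz
      have p1 := (h1 t ht).2 z hz
      have p2 := (h2 t ht).2 z hz
      have q1 := congrFun (e1 t) z
      have q2 := congrFun (e2 t) z
      rw [q1] at p1
      rw [q2] at p2
      rw [mem_closedBall_zero_iff, norm4_le] at hz
      rw [norm4_le]
      simp only [NNReal.coe_max]
      have hR : R ≤ (R.toNNReal : ℝ) := Real.le_coe_toNNReal R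
      have g1 := le_max_left (max (L1 : ℝ) L2) (R.toNNReal : ℝ)
      have g2 := le_max_right (max (L1 : ℝ) L2) (R.toNNReal : ℝ)
      have g3 := le_max_left (L1 : ℝ) L2
      have g4 := le_max_right (L1 : ℝ) L2
      refine ⟨?_, ?_, ?_, ?_⟩
      · exact hz.2.1.trans (hR.trans g2)
      · exact p1.trans (g3.trans g1)
      · exact hz.2.2.2.trans (hR.trans g2)
      · exact p2.trans (g4.trans g1)

/-- For the `T`-periodic pendulum-on-a-cart system, if `μ ∈ M = {0 < q < π}` is an
equilibrium admitting a `T`-periodic time-dependent Lyapunov function `V(z,t)` (zero at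
`μ`, positive on `U \ {μ}`, with negative total derivative `∂V/∂t + ∇_z V · f` along the
system on `U \ {μ}`), then for any `t₀` there are an open neighborhood `B ⊆ M` of `μ` and
an initial condition with `0 < q₀ < π` whose solutions stay in `M \ B` for all `t ≥ t₀` in
their interval of existence: global stabilization of `μ` is impossible. -/
theorem cart_pendulum_periodic_no_global_stabilization
    (m : ℝ) (hm : 0 < m)
    (u : ℝ → ℝ → ℝ → ℝ → ℝ → ℝ)
    (hu_cont : Continuous fun x : ℝ × ℝ × ℝ × ℝ × ℝ =>
      u x.1 x.2.1 x.2.2.1 x.2.2.2.1 x.2.2.2.2)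
    (hu_lip : ∀ K : Set (ℝ × ℝ × ℝ × ℝ × ℝ), IsCompact K → ∃ L : ℝ,
      ∀ a ∈ K, ∀ b ∈ K, a.2.2.2.2 = b.2.2.2.2 →
        |u a.1 a.2.1 a.2.2.1 a.2.2.2.1 a.2.2.2.2
          - u b.1 b.2.1 b.2.2.1 b.2.2.2.1 b.2.2.2.2| ≤
          L * dist ((a.1, a.2.1, a.2.2.1, a.2.2.2.1) : ℝ × ℝ × ℝ × ℝ)
                   ((b.1, b.2.1, b.2.2.1, b.2.2.2.1) : ℝ × ℝ × ℝ × ℝ))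
    (T : ℝ) (hT : 0 < T)
    (hu_per : ∀ q p x y t : ℝ, u q p x y (t + T) = u q p x y t)
    (μ : ℝ × ℝ × ℝ × ℝ) (hμM : 0 < μ.1 ∧ μ.1 < π)
    (hμrest : μ.2.1 = 0 ∧ μ.2.2.2 = 0)
    (hμequil : ∀ t : ℝ, cartPAcc m u μ t = 0 ∧ cartYAcc m u μ t = 0)
    (U : Set (ℝ × ℝ × ℝ × ℝ)) (hUclosed : IsClosed U)
    (hUM : U ⊆ {z : ℝ × ℝ × ℝ × ℝ | 0 < z.1 ∧ z.1 < π})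
    (hμint : μ ∈ interior U)
    (V : (ℝ × ℝ × ℝ × ℝ) × ℝ → ℝ)
    (DV : (ℝ × ℝ × ℝ × ℝ) × ℝ → ((ℝ × ℝ × ℝ × ℝ) × ℝ) →L[ℝ] ℝ)
    (hVdiff : ∀ z ∈ U, ∀ t : ℝ, HasFDerivAt V (DV (z, t)) (z, t))
    (hDVcont : ContinuousOn DV (U ×ˢ (univ : Set ℝ)))
    (hVper : ∀ z : ℝ × ℝ × ℝ × ℝ, ∀ t : ℝ, V (z, t + T) = V (z, t))
    (hL1a : ∀ t : ℝ, V (μ, t) = 0)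
    (hL1b : ∀ z ∈ U, z ≠ μ → ∀ t : ℝ, 0 < V (z, t))
    (hL2 : ∀ t : ℝ, ∀ z ∈ U, z ≠ μ →
      DV (z, t) ((z.2.1, cartPAcc m u z t, z.2.2.2, cartYAcc m u z t), 1) < 0) :
    ∀ t₀ : ℝ,
      ∃ (q₀ p₀ x₀ y₀ : ℝ) (B : Set (ℝ × ℝ × ℝ × ℝ)),
        0 < q₀ ∧ q₀ < π ∧
        IsOpen B ∧ μ ∈ B ∧ B ⊆ {z : ℝ × ℝ × ℝ × ℝ | 0 < z.1 ∧ z.1 < π} ∧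
        ∀ I : Set ℝ, t₀ ∈ I → I.OrdConnected →
          ∀ q p x y : ℝ → ℝ,
            (∀ t ∈ I, HasDerivWithinAt q (p t) I t) →
            (∀ t ∈ I, HasDerivWithinAt p (cartPAcc m u (q t, p t, x t, y t) t) I t) →
            (∀ t ∈ I, HasDerivWithinAt x (y t) I t) →
            (∀ t ∈ I, HasDerivWithinAt y (cartYAcc m u (q t, p t, x t, y t) t) I t) →
            q t₀ = q₀ → p t₀ = p₀ → x t₀ = x₀ → y t₀ = y₀ →
            ∀ t ∈ I, t₀ ≤ t →
              (0 < q t ∧ q t < π) ∧ (q t, p t, x t, y t) ∉ B := by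
  intro t₀
  have hper : ∀ (z : ℝ × ℝ × ℝ × ℝ) (t : ℝ), ∃ t' ∈ Icc 0 T, V (z, t) = V (z, t') := by
    intro z t
    have hp : Function.Periodic (fun t => V (z, t)) T := fun t => hVper z t
    obtain ⟨t', ht', e⟩ := hp.exists_mem_Ico₀ hT t
    exact ⟨t', ⟨ht'.1, ht'.2.le⟩, e⟩
  obtain ⟨r, hr, hrU⟩ := Metric.nhds_basis_closedBall.mem_iff.1 (mem_interior_iff_mem_nhds.1 hμint)
  have hVc : ContinuousOn V (closedBall μ r ×ˢ (univ : Set ℝ)) := fun w hw =>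
    (hVdiff w.1 (hrU hw.1) w.2).continuousAt.continuousWithinAt
  -- positive lower bound on the sphere
  obtain ⟨c, hc, hsph⟩ : ∃ c, 0 < c ∧ ∀ z ∈ sphere μ r, ∀ t, c ≤ V (z, t) := by
    have hcomp : IsCompact (sphere μ r ×ˢ Icc 0 T) := (isCompact_sphere μ r).prod isCompact_Icc
    rcases (sphere μ r ×ˢ Icc 0 T).eq_empty_or_nonempty with h | h
    · refine ⟨1, one_pos, fun z hz t => ?_⟩
      have : (z, (0 : ℝ)) ∈ sphere μ r ×ˢ Icc 0 T := ⟨hz, le_rfl, hT.le⟩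
      rw [h] at this
      exact this.elim
    · obtain ⟨w, hw, hmin⟩ := hcomp.exists_isMinOn h
        (hVc.mono (prod_mono sphere_subset_closedBall (subset_univ _)))
      refine ⟨V w, hL1b w.1 (hrU (sphere_subset_closedBall hw.1)) ?_ w.2, fun z hz t => ?_⟩
      · intro e
        have := hw.1
        rw [e, mem_sphere, dist_self] at this
        exact hr.ne this
      · obtain ⟨t', ht', e⟩ := hper z t
        rw [e]
        exact hmin (show (z, t') ∈ sphere μ r ×ˢ Icc 0 T from ⟨hz, ht'⟩)
  set N : Set ((ℝ × ℝ × ℝ × ℝ) × ℝ) := (ball μ r ×ˢ univ) ∩ V ⁻¹' (Iio c) with hNdef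
  have hNo : IsOpen N :=
    (hVc.mono (prod_mono ball_subset_closedBall le_rfl)).isOpen_inter_preimage
      (isOpen_ball.prod isOpen_univ) isOpen_Iio
  have hμN : ∀ t, (μ, t) ∈ N := fun t =>
    ⟨⟨mem_ball_self hr, trivial⟩, by rw [mem_preimage, hL1a]; exact hc⟩
  have hDVneg : ∀ z ∈ closedBall μ r, ∀ t, DV (z, t) (cartV m u t z, 1) ≤ 0 := by
    intro z hz t
    by_cases hzμ : z = μ
    · subst hzμ
      have e : cartV m u t z = 0 := by
        unfold cartV
        rw [hμrest.1, hμrest.2, (hμequil t).1, (hμequil t).2]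
        rfl
      rw [e]
      have h1 : HasDerivAt (fun s : ℝ => (z, s)) ((0 : ℝ × ℝ × ℝ × ℝ), (1 : ℝ)) t :=
        (hasDerivAt_const t z).prodMk (hasDerivAt_id t)
      have h2 : HasDerivAt (fun s : ℝ => V (z, s)) (DV (z, t) (0, 1)) t :=
        HasFDerivAt.comp_hasDerivAt (f := fun s : ℝ => (z, s)) t (hVdiff z (hrU hz) t) h1
      have h3 : HasDerivAt (fun s : ℝ => V (z, s)) 0 t := by
        simp only [hL1a]
        exact hasDerivAt_const t 0
      exact (h2.unique h3).le
    · exact (hL2 t z (hrU hz) hzμ).le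
  have hNM : ∀ w ∈ N, 0 < w.1.1 ∧ w.1.1 < π := fun w hw =>
    hUM (hrU (ball_subset_closedBall hw.1.1))
  obtain ⟨z0, hz0⟩ := sol_path (cartV_llip m hm u hu_cont hu_lip) (fun _ _ => rfl)
    (fun z t hz => by
      simp only [cartV, cartPAcc, hz, Real.sin_zero, Real.cos_zero]
      rw [div_neg_iff]
      right
      constructor <;> nlinarith)
    (fun z t hz => by
      simp only [cartV, cartPAcc, hz, Real.sin_pi, Real.cos_pi]
      apply div_pos <;> nlinarith)
    N hNo hNM
    (fun γ a b hγ hab h => by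
      have := sol_invariant hγ μ V DV r c (fun z hz t => hVdiff z (hrU hz) t) hDVneg hsph
        h.1.1 h.2 b ⟨hab, le_rfl⟩
      exact ⟨⟨this.1, trivial⟩, this.2⟩)
    μ hμN hμrest.1 t₀
  obtain ⟨B, W, hBo, -, hμB, hTW, hBW⟩ := generalized_tube_lemma (isCompact_singleton (x := μ))
    (isCompact_Icc (a := 0) (b := T)) hNo (by
      rintro ⟨z, t⟩ ⟨hz, -⟩
      have hz' : z = μ := hz
      rw [hz']
      exact hμN t)
  have hBN : ∀ z ∈ B, ∀ t, (z, t) ∈ N := by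
    intro z hz t
    obtain ⟨t', ht', e⟩ := hper z t
    have h := hBW (show (z, t') ∈ B ×ˢ W from ⟨hz, hTW ht'⟩)
    exact ⟨⟨h.1.1, trivial⟩, by rw [mem_preimage, e]; exact h.2⟩
  have h00 := (hz0 t₀ le_rfl (fun _ => z0) (isSol_const _ _ _) rfl).1
  refine ⟨z0.1, z0.2.1, z0.2.2.1, z0.2.2.2, B, h00.1, h00.2, hBo, hμB rfl,
    fun z hz => hNM _ (hBN z hz 0), ?_⟩
  intro I ht₀ hI q p x y hq hp hx hy hq0 hp0 hx0 hy0 t ht htt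
  have hsub : Icc t₀ t ⊆ I := hI.out ht₀ ht
  have hsol : IsSol (cartV m u) (fun t => (q t, p t, x t, y t)) t₀ t := by
    intro s hs
    have hsI := hsub hs
    exact ((hq s hsI).prodMk ((hp s hsI).prodMk ((hx s hsI).prodMk (hy s hsI)))).mono hsub
  have := hz0 t htt _ hsol (by simp only [hq0, hp0, hx0, hy0])
  exact ⟨this.1, fun h => this.2 (hBN _ h t)⟩
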